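/- Let B = (𝓑_i)_{i∈S} be a collection of finite nonempty subsets of ℤ^n, and let I, J ⊆ S be two distinct subsets, each of which has defect equal to the minimal defect d(B) and is minimal by inclusion with this property (i.e., every proper subset of I, resp. of J, has defect strictly greater than d(B)). Then I ∩ J = ∅. -/

import Mathlib

noncomputable section

/-- `L(J)`: the `ℝ`-linear span of all differences `a - b` with `a, b ∈ B i` for some `i ∈ J`. -/
def colSpan {ι V : Type*} [AddCommGroup V] [Module ℝ V]
    (B : ι → Set V) (J : Set ι) : Submodule ℝ V :=
  Submodule.span ℝ {v | ∃ i ∈ J, ∃ a ∈ B i, ∃ b ∈ B i, v = a - b}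

/-- The defect `def(J) = dim L(J) - |J|`. -/
def colDefect {ι V : Type*} [AddCommGroup V] [Module ℝ V]
    (B : ι → Set V) (J : Finset ι) : ℤ :=
  (Module.finrank ℝ (colSpan B (J : Set ι)) : ℤ) - (J.card : ℤ)

/-- The minimal defect `min_{J ⊆ S} def(J)` over all subsets of `S` (including `∅`). -/
def colMinDefectOn {ι V : Type*} [AddCommGroup V] [Module ℝ V]
    (B : ι → Set V) (S : Finset ι) : ℤ :=
  S.powerset.inf' ⟨∅, Finset.empty_mem_powerset S⟩ (fun J => colDefect B J)

/-- A finite subset of `ℤ^n` viewed inside `ℝ^n`. -/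
def realize {n : ℕ} (A : Finset (Fin n → ℤ)) : Set (Fin n → ℝ) :=
  (fun a : Fin n → ℤ => fun j => (a j : ℝ)) '' (A : Set (Fin n → ℤ))

theorem colSpan_mono {ι V : Type*} [AddCommGroup V] [Module ℝ V]
    (B : ι → Set V) {I J : Set ι} (h : I ⊆ J) : colSpan B I ≤ colSpan B J :=
  Submodule.span_mono fun _ ⟨i, hi, hv⟩ => ⟨i, h hi, hv⟩

theorem colSpan_union_le {ι V : Type*} [AddCommGroup V] [Module ℝ V]
    (B : ι → Set V) (I J : Set ι) : colSpan B (I ∪ J) ≤ colSpan B I ⊔ colSpan B J := by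
  refine Submodule.span_le.2 ?_
  rintro v ⟨i, hi | hi, hv⟩
  · exact Submodule.mem_sup_left (Submodule.subset_span ⟨i, hi, hv⟩)
  · exact Submodule.mem_sup_right (Submodule.subset_span ⟨i, hi, hv⟩)

/-- The defect is submodular. -/
theorem colDefect_union_add_inter_le {ι V : Type*} [DecidableEq ι] [AddCommGroup V] [Module ℝ V]
    [FiniteDimensional ℝ V] (B : ι → Set V) (I J : Finset ι) :
    colDefect B (I ∪ J) + colDefect B (I ∩ J) ≤ colDefect B I + colDefect B J := by
  have hunion := Submodule.finrank_mono (colSpan_union_le B (I : Set ι) J)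
  have hinter := Submodule.finrank_mono (le_inf
    (colSpan_mono B (Set.inter_subset_left (s := (I : Set ι)) (t := J)))
    (colSpan_mono B (Set.inter_subset_right (s := (I : Set ι)) (t := J))))
  have hdim := Submodule.finrank_sup_add_finrank_inf_eq
    (colSpan B (I : Set ι)) (colSpan B (J : Set ι))
  have hcard := Finset.card_union_add_card_inter I J
  rw [← Finset.coe_union] at hunion
  rw [← Finset.coe_inter] at hinter
  unfold colDefect
  omega

theorem colMinDefectOn_le {ι V : Type*} [AddCommGroup V] [Module ℝ V]
    (B : ι → Set V) {S J : Finset ι} (h : J ⊆ S) : colMinDefectOn B S ≤ colDefect B J :=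
  Finset.inf'_le _ (Finset.mem_powerset.2 h)

/-- Two distinct subsets, each of minimal defect and minimal by inclusion
with this property, are disjoint. -/
theorem essential_inter_empty {n : ℕ} (hn : 1 ≤ n) {ι : Type*} [Fintype ι] [DecidableEq ι]
    (B : ι → Finset (Fin n → ℤ)) (hB : ∀ i, (B i).Nonempty)
    (I J : Finset ι) (hne : I ≠ J)
    (hI : colDefect (fun i => realize (B i)) I =
      colMinDefectOn (fun i => realize (B i)) Finset.univ)
    (hImin : ∀ I' : Finset ι, I' ⊂ I →
      colMinDefectOn (fun i => realize (B i)) Finset.univ <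
        colDefect (fun i => realize (B i)) I')
    (hJ : colDefect (fun i => realize (B i)) J =
      colMinDefectOn (fun i => realize (B i)) Finset.univ)
    (hJmin : ∀ J' : Finset ι, J' ⊂ J →
      colMinDefectOn (fun i => realize (B i)) Finset.univ <
        colDefect (fun i => realize (B i)) J') :
    I ∩ J = ∅ := by
  have hsub := colDefect_union_add_inter_le (fun i => realize (B i)) I J
  have hunion := colMinDefectOn_le (fun i => realize (B i)) (Finset.subset_univ (I ∪ J))
  have hinter : I ∩ J = I := by
    by_contra h
    have := hImin (I ∩ J) (Finset.inter_subset_left.ssubset_of_ne h)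
    omega
  have := hJmin I ((Finset.inter_eq_left.1 hinter).ssubset_of_ne hne)
  omega
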